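/- arXiv:2512.15487 — 2 statements merged into one kernel-verified Lean document; each statement's English description precedes it below -/
import Mathlib

section
/- The multiplication operator ζ ↦ m̃(D)^{-1}(ζ* · ζ) is a compact operator from Y^{1+θ} to Y^{1+θ}, whenever ζ* is a bounded continuous function on ℝ² that decays at infinity (sup_{|(x,y)|>n}|ζ*(x,y)| → 0 as n → ∞). -/
open MeasureTheory

/-- The anisotropic KP weight `(1 + k₁² + k₂²/k₁²)^r`. -/
noncomputable def wgt (r : ℝ) (k : ℝ × ℝ) : ℝ := (1 + k.1 ^ 2 + k.2 ^ 2 / k.1 ^ 2) ^ r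

/-- The squared `Y^r` norm, computed on the Fourier side. -/
noncomputable def YnormSq (r : ℝ) (g : ℝ × ℝ → ℂ) : ℝ := ∫ k : ℝ × ℝ, wgt r k * ‖g k‖ ^ 2

/-- The KP symbol `m̃(k) = 1 + k₂²/k₁² + ½(β - 1/3)k₁²`. -/
noncomputable def mKP (β : ℝ) (k : ℝ × ℝ) : ℝ :=
  1 + k.2 ^ 2 / k.1 ^ 2 + (1 / 2) * (β - 1 / 3) * k.1 ^ 2

/-- The Fourier transform on ℝ². -/
noncomputable def FT (f : ℝ × ℝ → ℂ) : ℝ × ℝ → ℂ := fun k =>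
  ∫ x : ℝ × ℝ, Complex.exp (-((2 * Real.pi * (x.1 * k.1 + x.2 * k.2) : ℝ) : ℂ) * Complex.I) * f x

/-- The inverse Fourier transform on ℝ². -/
noncomputable def invFT (g : ℝ × ℝ → ℂ) : ℝ × ℝ → ℂ := fun x =>
  ∫ k : ℝ × ℝ, Complex.exp (((2 * Real.pi * (x.1 * k.1 + x.2 * k.2) : ℝ) : ℂ) * Complex.I) * g k


open Filter Topology

lemma wint_aux (θ : ℝ) (hθ : 1 / 2 < θ) : Integrable (fun k : ℝ × ℝ => wgt (-(1 + θ)) k) := by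
  obtain ⟨ε, hε, rfl⟩ : ∃ ε : ℝ, 0 < ε ∧ θ = 1 / 2 + 2 * ε := ⟨(θ - 1/2)/2, by linarith, by ring⟩
  have hS : Integrable (fun s : ℝ => (1 + s ^ 2) ^ (-(1 / 2 + ε))) := by
    have := integrable_rpow_neg_one_add_norm_sq (E := ℝ) (μ := volume) (r := 1 + 2 * ε) (by simp; linarith)
    refine this.congr (Eventually.of_forall fun s => ?_)
    simp only [Real.norm_eq_abs, sq_abs]; congr 1; ring
  have hmeas : AEStronglyMeasurable (fun k : ℝ × ℝ =>
      (1 + k.1 ^ 2) ^ (-(1 + ε)) * (1 + (k.2 / k.1) ^ 2) ^ (-(1 / 2 + ε))) (volume.prod volume) := by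
    apply Measurable.aestronglyMeasurable; fun_prop
  have hP : Integrable (fun k : ℝ × ℝ =>
      (1 + k.1 ^ 2) ^ (-(1 + ε)) * (1 + (k.2 / k.1) ^ 2) ^ (-(1 / 2 + ε))) := by
    rw [Measure.volume_eq_prod, integrable_prod_iff hmeas]
    constructor
    · have h0 : ∀ᵐ x : ℝ, x ≠ 0 := by simp [ae_iff]
      filter_upwards [h0] with x hx
      exact (hS.comp_div hx).const_mul _
    · have key : ∀ x : ℝ, ∫ y : ℝ, ‖(1 + x ^ 2) ^ (-(1 + ε)) * (1 + (y / x) ^ 2) ^ (-(1 / 2 + ε))‖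
          = (1 + x ^ 2) ^ (-(1 + ε)) * (|x| * ∫ s : ℝ, (1 + s ^ 2) ^ (-(1 / 2 + ε))) := by
        intro x
        have : ∀ y : ℝ, ‖(1 + x ^ 2) ^ (-(1 + ε)) * (1 + (y / x) ^ 2) ^ (-(1 / 2 + ε))‖ =
          (1 + x ^ 2) ^ (-(1 + ε)) * (1 + (y / x) ^ 2) ^ (-(1 / 2 + ε)) := fun y =>
            Real.norm_of_nonneg (by positivity)
        simp_rw [this]
        rw [integral_const_mul, Measure.integral_comp_div (fun s : ℝ => (1 + s ^ 2) ^ (-(1 / 2 + ε)))]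
        simp
      simp_rw [key]
      simp_rw [← mul_assoc]
      apply Integrable.mul_const
      refine hS.mono' (by fun_prop) (Eventually.of_forall fun x => ?_)
      rw [Real.norm_of_nonneg (by positivity)]
      have h1 : |x| ≤ (1 + x ^ 2) ^ (1 / 2 : ℝ) := by
        rw [← Real.sqrt_eq_rpow]; exact Real.abs_le_sqrt (by linarith)
      calc (1 + x ^ 2) ^ (-(1 + ε)) * |x| ≤ (1 + x ^ 2) ^ (-(1 + ε)) * (1 + x ^ 2) ^ (1 / 2 : ℝ) := by
            gcongr
        _ = _ := by rw [← Real.rpow_add (by positivity)]; congr 1; ring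
  refine hP.mono' (by apply Measurable.aestronglyMeasurable; unfold wgt; fun_prop) (Eventually.of_forall fun k => ?_)
  unfold wgt
  rw [Real.norm_of_nonneg (by positivity)]
  have e : (1 + k.1 ^ 2 + k.2 ^ 2 / k.1 ^ 2) ^ (-(1 + (1 / 2 + 2 * ε))) =
    (1 + k.1 ^ 2 + k.2 ^ 2 / k.1 ^ 2) ^ (-(1 + ε)) * (1 + k.1 ^ 2 + k.2 ^ 2 / k.1 ^ 2) ^ (-(1 / 2 + ε)) := by
    rw [← Real.rpow_add (by positivity)]; congr 1; ring
  rw [e, div_pow]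
  have h1 : 0 ≤ k.2 ^ 2 / k.1 ^ 2 := by positivity
  have h2 : 0 ≤ k.1 ^ 2 := by positivity
  apply mul_le_mul
  · exact Real.rpow_le_rpow_of_nonpos (by positivity) (by linarith) (by linarith)
  · exact Real.rpow_le_rpow_of_nonpos (by positivity) (by linarith) (by linarith)
  · positivity
  · positivity

open FourierTransform SchwartzMap ContDiff in
lemma planch_aux {V : Type*} [NormedAddCommGroup V] [InnerProductSpace ℝ V] [MeasurableSpace V]
    [BorelSpace V] [FiniteDimensional ℝ V] (f : V → ℂ) (hf : Integrable f) (hf2 : MemLp f 2) :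
    MemLp (𝓕 f) 2 ∧ eLpNorm (𝓕 f) 2 volume = eLpNorm f 2 volume := by
  let F : Lp ℂ 2 (volume : Measure V) := hf2.toLp f
  have hcont : Continuous (𝓕 f) :=
    VectorFourier.fourierIntegral_continuous Real.continuous_fourierChar
      (by exact continuous_inner) hf
  have hae : 𝓕 f =ᵐ[volume] (𝓕 F : Lp ℂ 2 (volume : Measure V)) := by
    apply ae_eq_of_integral_contDiff_smul_eq hcont.locallyIntegrable
      ((Lp.memLp (𝓕 F)).locallyIntegrable (by norm_num))
    intro φ hφ hφc
    let ψ : V → ℂ := fun x => (φ x : ℂ)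
    have hψc : HasCompactSupport ψ := hφc.comp_left (g := fun x : ℝ => (x : ℂ)) (by simp)
    have hψs : ContDiff ℝ ∞ ψ := Complex.ofRealCLM.contDiff.comp hφ
    let S : 𝓢(V, ℂ) := hψc.toSchwartzMap hψs
    have hS : ∀ x, S x = (φ x : ℂ) := fun x => rfl
    have h1 := congrArg (fun T : 𝓢'(V, ℂ) => T S) (Lp.fourier_toTemperedDistribution_eq F)
    simp only [TemperedDistribution.fourier_apply, Lp.toTemperedDistribution_apply] at h1
    have h2 : ∫ x, φ x • (𝓕 F : Lp ℂ 2 (volume : Measure V)) x = ∫ x, S x • (𝓕 F : Lp ℂ 2 (volume : Measure V)) x := by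
      simp [hS]
    have h3 : ∫ x, φ x • 𝓕 f x = ∫ x, S x • 𝓕 f x := by
      simp [hS]
    rw [h2, h3, ← h1]
    have h4 : ∫ x, (𝓕 S) x • F x = ∫ x, (𝓕 S) x • f x := by
      apply integral_congr_ae
      filter_upwards [hf2.coeFn_toLp] with x hx
      rw [hx]
    rw [h4]
    have := VectorFourier.integral_fourierIntegral_smul_eq_flip (L := innerₗ V)
      (e := Real.fourierChar) (μ := volume) (ν := volume) (f := S) (g := f)
      Real.continuous_fourierChar (by exact continuous_inner) S.integrable hf
    rw [SchwartzMap.fourier_coe]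
    rw [flip_innerₗ] at this
    exact this.symm
  refine ⟨(memLp_congr_ae hae).2 (Lp.memLp _), ?_⟩
  rw [eLpNorm_congr_ae hae]
  have := Lp.norm_fourier_eq F
  rw [Lp.norm_def, Lp.norm_def, ENNReal.toReal_eq_toReal_iff' (Lp.eLpNorm_ne_top _) (Lp.eLpNorm_ne_top _)] at this
  rw [this]
  exact eLpNorm_congr_ae hf2.coeFn_toLp

lemma FT_eq (f : ℝ × ℝ → ℂ) (k : WithLp 2 (ℝ × ℝ)) :
    FT f k.ofLp = FourierTransform.fourier (fun x : WithLp 2 (ℝ × ℝ) => f x.ofLp) k := by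
  rw [Real.fourier_eq']
  unfold FT
  rw [← (WithLp.volume_preserving_ofLp ℝ ℝ).integral_comp (MeasurableEquiv.toLp 2 (ℝ × ℝ)).symm.measurableEmbedding]
  congr 1
  ext x
  simp only [WithLp.prod_inner_apply, smul_eq_mul]
  congr 2
  simp
  ring

lemma planchFT (f : ℝ × ℝ → ℂ) (hf : Integrable f) (hf2 : MemLp f 2) :
    MemLp (FT f) 2 ∧ eLpNorm (FT f) 2 volume = eLpNorm f 2 volume := by
  have hp := WithLp.volume_preserving_ofLp ℝ ℝ
  have hq := WithLp.volume_preserving_toLp ℝ ℝ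
  have h1 : Integrable (fun x : WithLp 2 (ℝ × ℝ) => f x.ofLp) := hp.integrable_comp_of_integrable hf
  have h2 : MemLp (fun x : WithLp 2 (ℝ × ℝ) => f x.ofLp) 2 := hf2.comp_measurePreserving hp
  obtain ⟨h3, h4⟩ := planch_aux _ h1 h2
  have e : FT f = (FourierTransform.fourier (fun x : WithLp 2 (ℝ × ℝ) => f x.ofLp)) ∘ WithLp.toLp 2 := by
    ext k; exact FT_eq f (WithLp.toLp 2 k)
  rw [e]
  refine ⟨h3.comp_measurePreserving hq, ?_⟩
  rw [eLpNorm_comp_measurePreserving h3.1 hq, h4]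
  exact eLpNorm_comp_measurePreserving hf2.1 hp

lemma invFT_eq (f : ℝ × ℝ → ℂ) : invFT f = FT f ∘ Neg.neg := by
  ext k
  simp [FT, invFT]
  congr 1
  ext x
  congr 2
  ring

lemma planchInv (f : ℝ × ℝ → ℂ) (hf : Integrable f) (hf2 : MemLp f 2) :
    MemLp (invFT f) 2 ∧ eLpNorm (invFT f) 2 volume = eLpNorm f 2 volume := by
  obtain ⟨h3, h4⟩ := planchFT f hf hf2
  have hn := Measure.measurePreserving_neg (volume : Measure (ℝ × ℝ))
  rw [invFT_eq]
  exact ⟨h3.comp_measurePreserving hn, (eLpNorm_comp_measurePreserving h3.1 hn).trans h4⟩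

lemma eLp_int {f g : ℝ × ℝ → ℂ} (hf : MemLp f 2) (hg : MemLp g 2)
    (h : eLpNorm f 2 volume = eLpNorm g 2 volume) : ∫ x, ‖f x‖ ^ 2 = ∫ x, ‖g x‖ ^ 2 := by
  rw [hf.eLpNorm_eq_integral_rpow_norm (by norm_num) (by norm_num),
    hg.eLpNorm_eq_integral_rpow_norm (by norm_num) (by norm_num),
    ENNReal.ofReal_eq_ofReal_iff (by positivity) (by positivity)] at h
  have := Real.rpow_left_injOn (x := ((2:ENNReal).toReal)⁻¹) (by norm_num) (by simp; positivity) (by simp; positivity) h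
  simpa using this

lemma conv_sub (G : ℕ → Lp ℂ 2 (volume : Measure (ℝ × ℝ))) (M : ℝ) (hG : ∀ n, ‖G n‖ ≤ M) :
    ∃ φ : ℕ → ℕ, StrictMono φ ∧ ∀ u : Lp ℂ 2 (volume : Measure (ℝ × ℝ)), ∃ l : ℂ,
      Tendsto (fun n => inner ℂ (G (φ n)) u) atTop (𝓝 l) := by
  have : Fact ((2 : ENNReal) ≠ ⊤) := ⟨by norm_num⟩
  have := WeakDual.isSeqCompact_closedBall ℂ (Lp ℂ 2 (volume : Measure (ℝ × ℝ))) 0 M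
  obtain ⟨a, -, φ, hφ, hT⟩ := this (x := fun n => StrongDual.toWeakDual (innerSL ℂ (G n))) (fun n => by
    simp [hG n])
  refine ⟨φ, hφ, fun u => ⟨a u, ?_⟩⟩
  exact ((WeakDual.eval_continuous u).tendsto a).comp hT

lemma one_le_base (k : ℝ × ℝ) : 1 ≤ 1 + k.1 ^ 2 + k.2 ^ 2 / k.1 ^ 2 := by
  have : 0 ≤ k.1 ^ 2 + k.2 ^ 2 / k.1 ^ 2 := by positivity
  linarith

lemma one_le_wgt {r : ℝ} (hr : 0 ≤ r) (k : ℝ × ℝ) : 1 ≤ wgt r k :=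
  Real.one_le_rpow (one_le_base k) hr

lemma wgt_meas (r : ℝ) : Measurable (wgt r) := by unfold wgt; fun_prop

lemma wgt_neg (r : ℝ) (k : ℝ × ℝ) : wgt (-r) k = (wgt r k)⁻¹ :=
  Real.rpow_neg (by linarith [one_le_base k]) _

lemma norm_char (x k : ℝ × ℝ) :
    ‖Complex.exp (((2 * Real.pi * (x.1 * k.1 + x.2 * k.2) : ℝ) : ℂ) * Complex.I)‖ = 1 :=
  Complex.norm_exp_ofReal_mul_I _

lemma g_bounds (θ : ℝ) (hθ : 1 / 2 < θ) (g : ℝ × ℝ → ℂ) (hm : Measurable g)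
    (hI : Integrable (fun k => wgt (1 + θ) k * ‖g k‖ ^ 2))
    (hb : YnormSq (1 + θ) g ≤ 1) :
    Integrable g ∧ MemLp g 2 ∧ (∫ k, ‖g k‖ ≤ 1 + ∫ k, wgt (-(1 + θ)) k) ∧ ∫ k, ‖g k‖ ^ 2 ≤ 1 := by
  have hw := wint_aux θ hθ
  have hW : ∀ k, 1 ≤ wgt (1 + θ) k := one_le_wgt (by linarith)
  have h1 : ∀ k, ‖g k‖ ≤ wgt (1 + θ) k * ‖g k‖ ^ 2 + wgt (-(1 + θ)) k := by
    intro k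
    rw [wgt_neg]
    have hk := hW k
    set w := wgt (1 + θ) k
    have h0 : 0 < w := by linarith
    have : 0 ≤ w⁻¹ * ((w * ‖g k‖ - 1 / 2) ^ 2 + 3 / 4) := by positivity
    have e : w⁻¹ * ((w * ‖g k‖ - 1 / 2) ^ 2 + 3 / 4) = w * ‖g k‖ ^ 2 + w⁻¹ - ‖g k‖ := by
      field_simp; ring
    linarith
  have h2 : ∀ k, ‖g k‖ ^ 2 ≤ wgt (1 + θ) k * ‖g k‖ ^ 2 := fun k =>
    le_mul_of_one_le_left (by positivity) (hW k)
  have hgi : Integrable g := (hI.add hw).mono' hm.aestronglyMeasurable (Eventually.of_forall h1)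
  have hg2 : Integrable (fun k => ‖g k‖ ^ 2) := hI.mono' (by fun_prop) (Eventually.of_forall fun k => by
    rw [Real.norm_of_nonneg (by positivity)]; exact h2 k)
  refine ⟨hgi, (memLp_two_iff_integrable_sq_norm hm.aestronglyMeasurable).2 hg2, ?_, ?_⟩
  · refine (integral_mono hgi.norm (hI.add hw) h1).trans ?_
    simp only [Pi.add_apply]
    rw [integral_add hI hw]
    unfold YnormSq at hb
    linarith
  · exact (integral_mono hg2 hI h2).trans hb

lemma conv_h (θ : ℝ) (hθ : 1 / 2 < θ)
    (g : ℕ → ℝ × ℝ → ℂ) (hm : ∀ n, Measurable (g n))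
    (hI : ∀ n, Integrable (fun k => wgt (1 + θ) k * ‖g n k‖ ^ 2))
    (hb : ∀ n, YnormSq (1 + θ) (g n) ≤ 1) :
    ∃ φ : ℕ → ℕ, StrictMono φ ∧ ∀ x, ∃ l : ℂ, Tendsto (fun n => invFT (g (φ n)) x) atTop (𝓝 l) := by
  have hW : ∀ k, 1 ≤ wgt (1 + θ) k := one_le_wgt (by linarith)
  have hWm := wgt_meas (1 + θ)
  have hsq : ∀ k, √(wgt (1 + θ) k) ≠ 0 := fun k => by
    have := hW k
    positivity
  have nG : ∀ n k, ‖(√(wgt (1 + θ) k) : ℂ) * g n k‖ ^ 2 = wgt (1 + θ) k * ‖g n k‖ ^ 2 := by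
    intro n k
    rw [norm_mul, mul_pow, Complex.norm_real, Real.norm_eq_abs, sq_abs, Real.sq_sqrt (by linarith [hW k])]
  have mG : ∀ n, MemLp (fun k => (√(wgt (1 + θ) k) : ℂ) * g n k) 2 := by
    intro n
    have := hm n
    rw [memLp_two_iff_integrable_sq_norm (by apply Measurable.aestronglyMeasurable; fun_prop)]
    simp_rw [nG]
    exact hI n
  let u : ℝ × ℝ → ℝ × ℝ → ℂ := fun x k => starRingEnd ℂ
    (Complex.exp (((2 * Real.pi * (x.1 * k.1 + x.2 * k.2) : ℝ) : ℂ) * Complex.I)) * (√(wgt (1 + θ) k) : ℂ)⁻¹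
  have mu : ∀ x, MemLp (u x) 2 := by
    intro x
    rw [memLp_two_iff_integrable_sq_norm]
    · refine (wint_aux θ hθ).congr (Eventually.of_forall fun k => ?_)
      simp only [u]
      rw [norm_mul, RCLike.norm_conj, norm_char, one_mul, norm_inv, Complex.norm_real, Real.norm_eq_abs, inv_pow, sq_abs,
        Real.sq_sqrt (by linarith [hW k]), wgt_neg]
    · apply AEStronglyMeasurable.mul
      · apply Continuous.aestronglyMeasurable; fun_prop
      · apply Measurable.aestronglyMeasurable; fun_prop
  obtain ⟨φ, hφ, h⟩ := conv_sub (fun n => (mG n).toLp _) 1 (fun n => by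
    have h1 : ‖(mG n).toLp _‖ ^ 2 ≤ 1 := by
      rw [← @inner_self_eq_norm_sq ℂ, L2.inner_def]
      have : ∫ a, inner ℂ ((mG n).toLp _ a) ((mG n).toLp _ a) = ((∫ a, wgt (1 + θ) a * ‖g n a‖ ^ 2 : ℝ) : ℂ) := by
        rw [← integral_complex_ofReal]
        apply integral_congr_ae
        filter_upwards [(mG n).coeFn_toLp] with a ha
        rw [ha, inner_self_eq_norm_sq_to_K]
        rw [← nG n a]
        push_cast
        rfl
      rw [this]
      exact hb n
    exact (sq_le_one_iff₀ (norm_nonneg _)).1 h1)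
  refine ⟨φ, hφ, fun x => ?_⟩
  obtain ⟨l, hl⟩ := h ((mu x).toLp _)
  refine ⟨starRingEnd ℂ l, ((Complex.continuous_conj.tendsto l).comp hl).congr fun n => ?_⟩
  simp only [Function.comp]
  rw [inner_conj_symm, L2.inner_def]
  apply integral_congr_ae
  filter_upwards [(mG (φ n)).coeFn_toLp, (mu x).coeFn_toLp] with k h1 h2
  rw [h1, h2, RCLike.inner_apply]
  simp only [u, map_mul, map_inv₀, Complex.conj_conj, Complex.conj_ofReal]
  have : (√(wgt (1 + θ) k) : ℂ) ≠ 0 := by exact_mod_cast hsq k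
  field_simp

lemma final_bound (β θ : ℝ) (hβ : 1 / 3 < β) (hθ : 1 / 2 < θ) (hθ1 : θ ≤ 1) :
    ∃ C : ℝ, 0 < C ∧ ∀ f : ℝ × ℝ → ℂ, MemLp f 2 →
      YnormSq (1 + θ) (fun k => ((mKP β k : ℝ) : ℂ)⁻¹ * FT f k) ≤ C * ∫ x, ‖f x‖ ^ 2 := by
  set A := 1 + 2 / (β - 1 / 3) with hA
  have hβ' : 0 < β - 1 / 3 := by linarith
  have hA0 : 0 < A := by positivity
  refine ⟨A ^ 2, by positivity, fun f hf => ?_⟩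
  have hn : 0 ≤ ∫ x, ‖f x‖ ^ 2 := integral_nonneg fun x => by positivity
  by_cases hi : Integrable f
  · obtain ⟨h1, h2⟩ := planchFT f hi hf
    rw [← eLp_int h1 hf h2, ← integral_const_mul]
    unfold YnormSq
    apply integral_mono_of_nonneg
    · exact Eventually.of_forall fun k => mul_nonneg (by linarith [one_le_wgt (r := 1 + θ) (by linarith) k]) (by positivity)
    · exact ((memLp_two_iff_integrable_sq_norm h1.1).1 h1).const_mul _
    · refine Eventually.of_forall fun k => ?_
      simp only
      rw [norm_mul, norm_inv, Complex.norm_real, Real.norm_eq_abs, mul_pow, inv_pow, sq_abs, ← mul_assoc]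
      refine mul_le_mul_of_nonneg_right ?_ (by positivity)
      have hq : 0 ≤ k.2 ^ 2 / k.1 ^ 2 := by positivity
      have hm : 1 ≤ mKP β k := by
        unfold mKP
        have : 0 ≤ (1 / 2) * (β - 1 / 3) * k.1 ^ 2 := by positivity
        linarith
      rw [← div_eq_mul_inv, div_le_iff₀ (by positivity), ← mul_pow]
      have hw : wgt (1 + θ) k ≤ (1 + k.1 ^ 2 + k.2 ^ 2 / k.1 ^ 2) ^ 2 := by
        unfold wgt
        rw [← Real.rpow_two (1 + k.1 ^ 2 + k.2 ^ 2 / k.1 ^ 2)]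
        exact Real.rpow_le_rpow_of_exponent_le (one_le_base k) (by linarith)
      refine hw.trans (pow_le_pow_left₀ (by linarith [one_le_base k]) ?_ 2)
      unfold mKP
      have e : A * (1 + k.2 ^ 2 / k.1 ^ 2 + 1 / 2 * (β - 1 / 3) * k.1 ^ 2) =
        (1 + k.1 ^ 2 + k.2 ^ 2 / k.1 ^ 2) + (1 / 2 * (β - 1 / 3) * k.1 ^ 2 + 2 / (β - 1 / 3) * (1 + k.2 ^ 2 / k.1 ^ 2)) := by
        rw [hA]
        have hne : β - 1 / 3 ≠ 0 := hβ'.ne'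
        generalize k.2 ^ 2 / k.1 ^ 2 = q
        generalize β - 1 / 3 = b at hne
        field_simp
        ring
      rw [e]
      have : 0 ≤ 1 / 2 * (β - 1 / 3) * k.1 ^ 2 + 2 / (β - 1 / 3) * (1 + k.2 ^ 2 / k.1 ^ 2) := by positivity
      linarith
  · have h0 : ∀ k, FT f k = 0 := by
      intro k
      apply integral_undef
      contrapose! hi
      have hc : Continuous fun x : ℝ × ℝ => Complex.exp (((2 * Real.pi * (x.1 * k.1 + x.2 * k.2) : ℝ) : ℂ) * Complex.I) := by
        fun_prop
      have := hi.bdd_mul (c := 1) hc.aestronglyMeasurable (Eventually.of_forall fun x => (norm_char x k).le)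
      refine this.congr (Eventually.of_forall fun x => ?_)
      simp only
      rw [← mul_assoc, ← Complex.exp_add]
      simp
    simp [YnormSq, h0]
    positivity

theorem stmt12 (β θ : ℝ) (hβ : 1 / 3 < β) (hθ : 1 / 2 < θ) (hθ1 : θ ≤ 1)
    (zst : ℝ × ℝ → ℂ) (hc : Continuous zst)
    (hdecay : ∀ η > (0 : ℝ), ∃ R : ℝ, ∀ p : ℝ × ℝ, R ≤ ‖p‖ → ‖zst p‖ ≤ η)
    (g : ℕ → ℝ × ℝ → ℂ) (hm : ∀ n, Measurable (g n))
    (hI : ∀ n, Integrable (fun k => wgt (1 + θ) k * ‖g n k‖ ^ 2))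
    (hb : ∀ n, YnormSq (1 + θ) (g n) ≤ 1) :
    ∃ φ : ℕ → ℕ, StrictMono φ ∧ ∀ η > (0 : ℝ), ∃ N : ℕ, ∀ m n : ℕ, N ≤ m → N ≤ n →
      Real.sqrt (YnormSq (1 + θ) (fun k => ((mKP β k : ℝ) : ℂ)⁻¹ *
        FT (fun x => zst x * (invFT (g (φ m)) x - invFT (g (φ n)) x)) k)) ≤ η := by
  obtain ⟨C, hC, hCf⟩ := final_bound β θ hβ hθ hθ1
  obtain ⟨φ, hφ, hlim⟩ := conv_h θ hθ g hm hI hb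
  have hbd := fun n => g_bounds θ hθ (g n) (hm n) (hI n) (hb n)
  set M := 1 + ∫ k, wgt (-(1 + θ)) k with hM
  let h : ℕ → ℝ × ℝ → ℂ := fun n => invFT (g (φ n))
  have hh2 : ∀ n, MemLp (h n) 2 := fun n => (planchInv _ (hbd (φ n)).1 (hbd (φ n)).2.1).1
  have hh1 : ∀ n, ∫ x, ‖h n x‖ ^ 2 ≤ 1 := fun n => by
    obtain ⟨a, b, -, c⟩ := hbd (φ n)
    obtain ⟨p, q⟩ := planchInv _ a b
    exact (eLp_int p b q).le.trans c
  have hhM : ∀ n x, ‖h n x‖ ≤ M := fun n x => by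
    refine (norm_integral_le_integral_norm _).trans ?_
    simp_rw [norm_mul, norm_char, one_mul]
    exact (hbd (φ n)).2.2.1
  have hM0 : 0 ≤ M := (norm_nonneg _).trans (hhM 0 0)
  obtain ⟨Z, hZ⟩ : ∃ Z, ∀ x, ‖zst x‖ ≤ Z := by
    obtain ⟨R, hR⟩ := hdecay 1 one_pos
    obtain ⟨Z, hZ⟩ := (isCompact_closedBall (0 : ℝ × ℝ) R).exists_bound_of_continuousOn hc.continuousOn
    refine ⟨max 1 Z, fun x => ?_⟩
    rcases le_total R ‖x‖ with hx | hx
    · exact (hR x hx).trans (le_max_left _ _)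
    · exact (hZ x (by simpa using hx)).trans (le_max_right _ _)
  have hZ0 : 0 ≤ Z := (norm_nonneg _).trans (hZ 0)
  have hd2 : ∀ m n, MemLp (fun x => h m x - h n x) 2 := fun m n => (hh2 m).sub (hh2 n)
  have sqi : ∀ {f : ℝ × ℝ → ℂ}, MemLp f 2 → Integrable (fun x => ‖f x‖ ^ 2) := fun hf =>
    (memLp_two_iff_integrable_sq_norm hf.1).1 hf
  have hd4 : ∀ m n, ∫ x, ‖h m x - h n x‖ ^ 2 ≤ 4 := fun m n => by
    have : ∫ x, ‖h m x - h n x‖ ^ 2 ≤ ∫ x, (2 * ‖h m x‖ ^ 2 + 2 * ‖h n x‖ ^ 2) := by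
      refine integral_mono (sqi (hd2 m n)) (((sqi (hh2 m)).const_mul 2).add ((sqi (hh2 n)).const_mul 2)) fun x => ?_
      have := norm_sub_le (h m x) (h n x)
      have := pow_le_pow_left₀ (norm_nonneg _) this 2
      simp only
      nlinarith [sq_nonneg (‖h m x‖ - ‖h n x‖)]
    rw [integral_add ((sqi (hh2 m)).const_mul 2) ((sqi (hh2 n)).const_mul 2), integral_const_mul, integral_const_mul] at this
    linarith [hh1 m, hh1 n]
  have hf2 : ∀ m n, MemLp (fun x => zst x * (h m x - h n x)) 2 := fun m n =>
    (hd2 m n).of_le_mul (c := Z) (hc.aestronglyMeasurable.mul (hd2 m n).1)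
      (Eventually.of_forall fun x => by
        rw [norm_mul]
        exact mul_le_mul_of_nonneg_right (hZ x) (norm_nonneg _))
  refine ⟨φ, hφ, fun η hη => ?_⟩
  -- tail cut-off
  set ε : ℝ := η ^ 2 / (2 * C) with hε
  have hε0 : 0 < ε := by positivity
  obtain ⟨R, hR⟩ := hdecay (√(ε / 4)) (by positivity)
  let B := Metric.closedBall (0 : ℝ × ℝ) R
  have hBm : MeasurableSet B := Metric.isClosed_closedBall.measurableSet
  have hT : Tendsto (fun p : ℕ × ℕ => ∫ x in B, ‖zst x * (h p.1 x - h p.2 x)‖ ^ 2) (atTop ×ˢ atTop) (𝓝 (∫ x in B, (0 : ℝ))) := by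
    apply tendsto_integral_filter_of_dominated_convergence (fun _ => (Z * (2 * M)) ^ 2)
    · exact Eventually.of_forall fun p => (sqi (hf2 p.1 p.2)).1.restrict
    · refine Eventually.of_forall fun p => Eventually.of_forall fun x => ?_
      rw [Real.norm_of_nonneg (by positivity)]
      apply pow_le_pow_left₀ (norm_nonneg _)
      rw [norm_mul]
      refine mul_le_mul (hZ x) ?_ (norm_nonneg _) hZ0
      linarith [norm_sub_le (h p.1 x) (h p.2 x), hhM p.1 x, hhM p.2 x]
    · have : IsFiniteMeasure (volume.restrict B) := ⟨by
        rw [Measure.restrict_apply_univ]; exact (isCompact_closedBall _ _).measure_lt_top⟩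
      exact integrable_const _
    · refine Eventually.of_forall fun x => ?_
      obtain ⟨l, hl⟩ := hlim x
      have := (hl.comp tendsto_fst).sub (hl.comp (tendsto_snd (f := (atTop : Filter ℕ))))
      have := ((this.const_mul (zst x)).norm).pow 2
      simpa using this
  rw [integral_zero, prod_atTop_atTop_eq] at hT
  obtain ⟨⟨N1, N2⟩, hN⟩ := eventually_atTop.1 (hT.eventually (gt_mem_nhds hε0))
  refine ⟨max N1 N2, fun m n hm' hn' => ?_⟩
  have hin := hN (m, n) ⟨(le_max_left _ _).trans hm', (le_max_right _ _).trans hn'⟩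
  simp only at hin
  have hout : ∫ x in Bᶜ, ‖zst x * (h m x - h n x)‖ ^ 2 ≤ ε := by
    calc ∫ x in Bᶜ, ‖zst x * (h m x - h n x)‖ ^ 2
        ≤ ∫ x in Bᶜ, ε / 4 * ‖h m x - h n x‖ ^ 2 := by
          apply setIntegral_mono_on (sqi (hf2 m n)).integrableOn ((sqi (hd2 m n)).const_mul _).integrableOn hBm.compl
          intro x hx
          have hx' : R ≤ ‖x‖ := by
            simp [B] at hx; exact hx.le
          rw [norm_mul, mul_pow]
          gcongr
          exact (Real.le_sqrt (norm_nonneg _) (by positivity)).1 (hR x hx')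
      _ ≤ ∫ x, ε / 4 * ‖h m x - h n x‖ ^ 2 :=
          setIntegral_le_integral ((sqi (hd2 m n)).const_mul _) (Eventually.of_forall fun x => by positivity)
      _ ≤ ε := by
          rw [integral_const_mul]
          nlinarith [hd4 m n]
  have hsum := integral_add_compl hBm (sqi (hf2 m n))
  have hY := hCf _ (hf2 m n)
  apply Real.sqrt_le_iff.2 ⟨hη.le, ?_⟩
  refine hY.trans ?_
  have e : η ^ 2 = C * (2 * ε) := by rw [hε]; field_simp
  rw [e]
  gcongr
  linarith
end

section
/- For each θ ∈ [0,1], |ε²/(ε² + n_ε(k)) - 1/m̃(k)| ≲ ε^{1-θ} (1 + k₁² + k₂²/k₁²)^{-(1+θ)/2} uniformly over |k₁| < δ/ε, |k₂/k₁| < δ/ε. -/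
/-- The FDKP-I dispersion symbol, with `tanh r / r` extended by `1` at `r = 0`. -/
noncomputable def mFDKP (β : ℝ) (k : ℝ × ℝ) : ℝ :=
  Real.sqrt (1 + β * (k.1 ^ 2 + k.2 ^ 2)) *
  Real.sqrt (if k = 0 then 1 else
    Real.tanh (Real.sqrt (k.1 ^ 2 + k.2 ^ 2)) / Real.sqrt (k.1 ^ 2 + k.2 ^ 2)) *
  Real.sqrt (1 + 2 * k.2 ^ 2 / k.1 ^ 2)

theorem aux_hasDerivAt_tanh (x : ℝ) : HasDerivAt Real.tanh (1 - Real.tanh x ^ 2) x := by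
  have h := (Real.hasDerivAt_sinh x).div (Real.hasDerivAt_cosh x) (Real.cosh_pos x).ne'
  have e : Real.tanh = fun y => Real.sinh y / Real.cosh y := by
    funext y; exact Real.tanh_eq_sinh_div_cosh y
  rw [e]
  refine h.congr_deriv ?_
  have := (Real.cosh_pos x).ne'
  field_simp

theorem aux_mono (f f' : ℝ → ℝ) (hf : ∀ x, HasDerivAt f (f' x) x) (h0 : f 0 = 0)
    (hp : ∀ x, 0 < x → 0 ≤ f' x) (r : ℝ) (hr : 0 ≤ r) : 0 ≤ f r := by
  have hm : MonotoneOn f (Set.Ici 0) := by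
    apply monotoneOn_of_deriv_nonneg (convex_Ici 0)
    · exact fun x _ => (hf x).continuousAt.continuousWithinAt
    · exact fun x _ => (hf x).differentiableAt.differentiableWithinAt
    · intro x hx
      rw [interior_Ici] at hx
      rw [(hf x).deriv]; exact hp x hx
  have := hm (Set.mem_Ici.2 le_rfl) (Set.mem_Ici.2 hr) hr
  rwa [h0] at this

theorem aux_tanh_nonneg (r : ℝ) (hr : 0 ≤ r) : 0 ≤ Real.tanh r := by
  rw [Real.tanh_eq_sinh_div_cosh]
  exact div_nonneg (Real.sinh_nonneg_iff.2 hr) (Real.cosh_pos r).le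

theorem aux_tanh_le (r : ℝ) (hr : 0 ≤ r) : Real.tanh r ≤ r := by
  have := aux_mono (fun x => x - Real.tanh x) (fun x => 1 - (1 - Real.tanh x ^ 2))
    (fun x => (hasDerivAt_id' x).sub (aux_hasDerivAt_tanh x)) (by simp)
    (fun x _ => by nlinarith [sq_nonneg (Real.tanh x)]) r hr
  simpa using this

theorem aux_tanh_lower (r : ℝ) (hr : 0 ≤ r) : r - r ^ 3 / 3 ≤ Real.tanh r := by
  have := aux_mono (fun x => Real.tanh x - (x - x ^ 3 / 3))
    (fun x => (1 - Real.tanh x ^ 2) - (1 - (3 : ℕ) * x ^ 2 / 3))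
    (fun x => (aux_hasDerivAt_tanh x).sub ((hasDerivAt_id' x).sub ((hasDerivAt_pow 3 x).div_const 3)))
    (by simp)
    (fun x hx => by
      have h1 := aux_tanh_nonneg x hx.le
      have h2 := aux_tanh_le x hx.le
      push_cast
      nlinarith) r hr
  linarith

theorem aux_tanh_upper (r : ℝ) (hr : 0 ≤ r) : Real.tanh r ≤ r - r ^ 3 / 3 + r ^ 5 / 5 := by
  have := aux_mono (fun x => (x - x ^ 3 / 3 + x ^ 5 / 5) - Real.tanh x)
    (fun x => (1 - (3 : ℕ) * x ^ 2 / 3 + (5 : ℕ) * x ^ 4 / 5) - (1 - Real.tanh x ^ 2))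
    (fun x => (((hasDerivAt_id' x).sub ((hasDerivAt_pow 3 x).div_const 3)).add
      ((hasDerivAt_pow 5 x).div_const 5)).sub (aux_hasDerivAt_tanh x))
    (by simp)
    (fun x hx => by
      have h1 := aux_tanh_nonneg x hx.le
      have h2 := aux_tanh_le x hx.le
      have h3 := aux_tanh_lower x hx.le
      have h4 : (x - Real.tanh x) * (x + Real.tanh x) ≤ (x ^ 3 / 3) * (2 * x) := by
        apply mul_le_mul <;> linarith
      have h5 : 0 ≤ x ^ 4 := by positivity
      push_cast
      nlinarith) r hr
  linarith

/-- Taylor bound for `tanh (√s) / √s`. -/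
theorem aux_T (s : ℝ) (hs : 0 < s) :
    0 ≤ Real.tanh (Real.sqrt s) / Real.sqrt s - (1 - s / 3) ∧
    Real.tanh (Real.sqrt s) / Real.sqrt s - (1 - s / 3) ≤ s ^ 2 := by
  have hr : 0 < Real.sqrt s := Real.sqrt_pos.2 hs
  have e : s = Real.sqrt s ^ 2 := (Real.sq_sqrt hs.le).symm
  generalize Real.sqrt s = r at *
  subst e
  have h1 := aux_tanh_lower r hr.le
  have h2 := aux_tanh_upper r hr.le
  have h5 : 0 < r ^ 5 := by positivity
  constructor
  · rw [sub_nonneg, le_div_iff₀ hr]; nlinarith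
  · rw [sub_le_iff_le_add, div_le_iff₀ hr]; nlinarith

theorem aux_m_sq (β : ℝ) (hβ : 1 / 3 < β) (a b : ℝ) (ha : a ≠ 0) :
    0 ≤ mFDKP β (a, a * b) ∧ ∃ e, 0 ≤ e ∧ e ≤ (a ^ 2 + a ^ 2 * b ^ 2) ^ 2 ∧
    mFDKP β (a, a * b) ^ 2 = (1 + β * (a ^ 2 + a ^ 2 * b ^ 2)) *
      (1 - (a ^ 2 + a ^ 2 * b ^ 2) / 3 + e) * (1 + 2 * b ^ 2) := by
  have hs : 0 < a ^ 2 + a ^ 2 * b ^ 2 := by positivity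
  obtain ⟨h1, h2⟩ := aux_T _ hs
  have hk : ((a, a * b) : ℝ × ℝ) ≠ 0 := fun h => ha (congrArg Prod.fst h)
  have h3 : 2 * (a * b) ^ 2 / a ^ 2 = 2 * b ^ 2 := by field_simp
  refine ⟨by unfold mFDKP; positivity, _, h1, h2, ?_⟩
  unfold mFDKP
  simp only [if_neg hk, h3]
  rw [mul_pow a b 2]
  rw [mul_pow, mul_pow, Real.sq_sqrt (by positivity), Real.sq_sqrt (div_nonneg (aux_tanh_nonneg _ (Real.sqrt_nonneg _)) (Real.sqrt_nonneg _)),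
    Real.sq_sqrt (by positivity)]
  ring

theorem aux_E (β : ℝ) (hβ : 1 / 3 < β) (A B e : ℝ) (hA : 0 ≤ A) (hA1 : A ≤ 1) (hB : 0 ≤ B)
    (hB1 : B ≤ 1) (he : 0 ≤ e) (he' : e ≤ (A + A * B) ^ 2) :
    |(1 + β * (A + A * B)) * (1 - (A + A * B) / 3 + e) * (1 + 2 * B) - 1
      - ((β - 1 / 3) * A + 2 * B)| ≤ (12 + 41 * β) * (A + B) ^ 2 := by
  have hAB : A * B ≤ A := by nlinarith
  have hAB0 : 0 ≤ A * B := by positivity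
  obtain ⟨s, hs⟩ : ∃ s, s = A + A * B := ⟨_, rfl⟩
  rw [← hs] at he' ⊢
  have hs0 : 0 ≤ s := by linarith
  have hs2 : s ≤ 2 * A := by linarith
  have hs2' : s ≤ 2 := by linarith
  obtain ⟨F, hF⟩ : ∃ F, F = e + β * s * e - β * s ^ 2 / 3 := ⟨_, rfl⟩
  have hβ0 : 0 < β := by linarith
  have hFu : F ≤ (1 + 3 * β) * s ^ 2 := by
    have : β * s * e ≤ β * 2 * s ^ 2 := by gcongr
    have : 0 ≤ β * s ^ 2 := by positivity
    nlinarith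
  have hFl : -((1 + 3 * β) * s ^ 2) ≤ F := by
    have : 0 ≤ β * s * e := by positivity
    have : 0 ≤ β * s ^ 2 := by positivity
    nlinarith [sq_nonneg s]
  have hFa : |F| ≤ (1 + 3 * β) * (4 * (A + B) ^ 2) := by
    have h4 : s ^ 2 ≤ 4 * (A + B) ^ 2 := by
      have : s ^ 2 ≤ (2 * (A + B)) ^ 2 := by gcongr; linarith
      nlinarith
    calc |F| ≤ (1 + 3 * β) * s ^ 2 := abs_le.2 ⟨hFl, hFu⟩
      _ ≤ _ := by gcongr
  have key : (1 + β * s) * (1 - s / 3 + e) * (1 + 2 * B) - 1 - ((β - 1 / 3) * A + 2 * B)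
      = F * (1 + 2 * B) + (β - 1 / 3) * (A * B + 2 * B * s) := by
    rw [hF, hs]; ring
  rw [key]
  have h1 : |F * (1 + 2 * B)| ≤ (1 + 3 * β) * (4 * (A + B) ^ 2) * 3 := by
    rw [abs_mul, abs_of_nonneg (by positivity : 0 ≤ 1 + 2 * B)]
    gcongr; linarith
  have h2 : |(β - 1 / 3) * (A * B + 2 * B * s)| ≤ β * (5 * (A + B) ^ 2) := by
    rw [abs_of_nonneg (mul_nonneg (by linarith) (by positivity))]
    have : B * s ≤ B * (2 * A) := by gcongr
    apply mul_le_mul _ _ (by positivity) hβ0.le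
    · linarith
    · nlinarith [sq_nonneg A, sq_nonneg B]
  calc _ ≤ _ := abs_add_le _ _
    _ ≤ _ := add_le_add h1 h2
    _ ≤ _ := by nlinarith [sq_nonneg (A + B), mul_nonneg hβ0.le (sq_nonneg (A + B))]

theorem aux_R (β : ℝ) (hβ : 1 / 3 < β) : ∃ C > (0 : ℝ), ∀ a b : ℝ, a ≠ 0 → a ^ 2 ≤ 1 → b ^ 2 ≤ 1 →
    |mFDKP β (a, a * b) - 1 - (1 / 2 * (β - 1 / 3) * a ^ 2 + b ^ 2)| ≤ C * (a ^ 2 + b ^ 2) ^ 2 := by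
  refine ⟨(12 + 41 * β) + (26 + 83 * β) ^ 2, by positivity, ?_⟩
  intro a b ha ha1 hb1
  obtain ⟨hm, e, he, he', hsq⟩ := aux_m_sq β hβ a b ha
  have hE := aux_E β hβ (a ^ 2) (b ^ 2) e (by positivity) ha1 (by positivity) hb1 he he'
  rw [← hsq] at hE
  generalize mFDKP β (a, a * b) = m at *
  have hA : 0 ≤ a ^ 2 := by positivity
  have hB : 0 ≤ b ^ 2 := by positivity
  generalize a ^ 2 = A at *
  generalize b ^ 2 = B at *
  have hβ0 : 0 < β := by linarith
  obtain ⟨q, hq⟩ : ∃ q, q = A + B := ⟨_, rfl⟩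
  rw [← hq] at hE ⊢
  have hq0 : 0 ≤ q := by linarith
  have hq2 : q ^ 2 ≤ 2 * q := by nlinarith
  have hx : |m ^ 2 - 1| ≤ (26 + 83 * β) * q := by
    have h1 : |(β - 1 / 3) * A + 2 * B| ≤ (β + 2) * q := by
      rw [abs_of_nonneg (add_nonneg (mul_nonneg (by linarith) hA) (by linarith))]
      rw [hq]; nlinarith [mul_nonneg hβ0.le hB]
    have h2 : (12 + 41 * β) * q ^ 2 ≤ (12 + 41 * β) * (2 * q) := by gcongr
    have h3 : m ^ 2 - 1 = (m ^ 2 - 1 - ((β - 1 / 3) * A + 2 * B)) + ((β - 1 / 3) * A + 2 * B) := by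
      ring
    rw [h3]
    calc _ ≤ _ := abs_add_le _ _
      _ ≤ _ := add_le_add hE h1
      _ ≤ _ := by nlinarith
  have hm1 : |m - 1| ≤ (26 + 83 * β) * q := by
    refine le_trans ?_ hx
    have : m ^ 2 - 1 = (m - 1) * (m + 1) := by ring
    rw [this, abs_mul, abs_of_nonneg (by linarith : 0 ≤ m + 1)]
    nlinarith [abs_nonneg (m - 1)]
  have hm2 : (m - 1) ^ 2 ≤ (26 + 83 * β) ^ 2 * q ^ 2 := by
    rw [← sq_abs, ← mul_pow]; gcongr
  rw [abs_le] at hE ⊢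
  have h0 : 0 ≤ (12 + 41 * β) * q ^ 2 := by positivity
  constructor <;> nlinarith [sq_nonneg (m - 1), hE.1, hE.2]

theorem stmt17 (β : ℝ) (hβ : 1 / 3 < β) (θ : ℝ) (hθ0 : 0 ≤ θ) (hθ1 : θ ≤ 1) :
    ∃ δ : ℝ, 0 < δ ∧ δ < 1 ∧ ∃ C > (0 : ℝ), ∀ ε : ℝ, 0 < ε → ε < 1 →
      ∀ k : ℝ × ℝ, k.1 ≠ 0 → |k.1| < δ / ε → |k.2 / k.1| < δ / ε →
      |ε ^ 2 / (ε ^ 2 + (mFDKP β (ε * k.1, ε ^ 2 * k.2) - 1)) - (mKP β k)⁻¹| ≤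
        C * ε ^ (1 - θ) * (1 + k.1 ^ 2 + k.2 ^ 2 / k.1 ^ 2) ^ (-(1 + θ) / 2) := by
  obtain ⟨C, hC, hR⟩ := aux_R β hβ
  obtain ⟨c, hc0, hc1, hcγ⟩ : ∃ c : ℝ, 0 < c ∧ c ≤ 1 ∧ c ≤ 1 / 2 * (β - 1 / 3) :=
    ⟨min 1 (1 / 2 * (β - 1 / 3)), lt_min one_pos (by linarith), min_le_left _ _, min_le_right _ _⟩
  obtain ⟨δ, hδ0, hδ1, hδc⟩ : ∃ δ : ℝ, 0 < δ ∧ δ ≤ 1 / 2 ∧ δ ≤ c / (4 * C) :=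
    ⟨min (1 / 2) (c / (4 * C)), lt_min (by norm_num) (by positivity), min_le_left _ _,
      min_le_right _ _⟩
  rw [le_div_iff₀ (by positivity)] at hδc
  refine ⟨δ, hδ0, by linarith, 3 * (2 * C / c ^ 2), by positivity, ?_⟩
  rintro ε hε hε1 ⟨x, y⟩ hx hxδ hyδ
  simp only at hx hxδ hyδ ⊢
  have hδδ : δ ^ 2 ≤ δ := by nlinarith
  have ha : (ε * x) ^ 2 ≤ δ ^ 2 := by
    rw [lt_div_iff₀ hε] at hxδ
    rw [sq_le_sq, abs_mul, abs_of_pos hε, abs_of_pos hδ0]; linarith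
  have hb : (ε * (y / x)) ^ 2 ≤ δ ^ 2 := by
    rw [lt_div_iff₀ hε] at hyδ
    rw [sq_le_sq, abs_mul, abs_of_pos hε, abs_of_pos hδ0]; linarith
  have hr := hR (ε * x) (ε * (y / x)) (mul_ne_zero hε.ne' hx) (by linarith) (by linarith)
  have e1 : ε * x * (ε * (y / x)) = ε ^ 2 * y := by field_simp
  rw [e1] at hr
  have hKP : (mKP β (x, y))⁻¹ = ε ^ 2 / (ε ^ 2 + (1 / 2 * (β - 1 / 3) * (ε * x) ^ 2 + (ε * (y / x)) ^ 2)) := by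
    have : ε ^ 2 + (1 / 2 * (β - 1 / 3) * (ε * x) ^ 2 + (ε * (y / x)) ^ 2) = ε ^ 2 * mKP β (x, y) := by
      unfold mKP; simp only; rw [← div_pow]; ring
    rw [this, div_mul_cancel_left₀ (by positivity)]
  have hW : ε ^ 2 * (1 + x ^ 2 + y ^ 2 / x ^ 2) = ε ^ 2 + ((ε * x) ^ 2 + (ε * (y / x)) ^ 2) := by
    rw [← div_pow]; ring
  have hW1 : 0 < 1 + x ^ 2 + y ^ 2 / x ^ 2 := by positivity
  rw [hKP]
  generalize 1 + x ^ 2 + y ^ 2 / x ^ 2 = W at *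
  generalize mFDKP β (ε * x, ε ^ 2 * y) = m at *
  have hA : 0 ≤ (ε * x) ^ 2 := by positivity
  have hB : 0 ≤ (ε * (y / x)) ^ 2 := by positivity
  generalize (ε * x) ^ 2 = A at *
  generalize (ε * (y / x)) ^ 2 = B at *
  have hP : c * (A + B) ≤ 1 / 2 * (β - 1 / 3) * A + B := by nlinarith
  generalize 1 / 2 * (β - 1 / 3) * A + B = P at *
  obtain ⟨q, hq⟩ : ∃ q, q = A + B := ⟨_, rfl⟩
  rw [← hq] at hr hP hW
  have hq0 : 0 ≤ q := by linarith
  have hqδ : q ≤ 2 * δ := by linarith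
  have hCq : C * q ^ 2 ≤ c / 2 * q := by
    have : C * q ≤ c / 2 := by nlinarith
    nlinarith
  have hε2 : 0 < ε ^ 2 := by positivity
  have hD1 : c / 2 * (ε ^ 2 + q) ≤ ε ^ 2 + (m - 1) := by
    have := (abs_le.1 hr).1
    nlinarith
  have hD2 : c * (ε ^ 2 + q) ≤ ε ^ 2 + P := by nlinarith
  have hS : 0 < ε ^ 2 + q := by linarith
  have hD1p : 0 < ε ^ 2 + (m - 1) := lt_of_lt_of_le (by positivity) hD1
  have hD2p : 0 < ε ^ 2 + P := lt_of_lt_of_le (by positivity) hD2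
  have main : |ε ^ 2 / (ε ^ 2 + (m - 1)) - ε ^ 2 / (ε ^ 2 + P)| ≤ 2 * C / c ^ 2 * ε ^ 2 := by
    have : ε ^ 2 / (ε ^ 2 + (m - 1)) - ε ^ 2 / (ε ^ 2 + P)
        = -(ε ^ 2 * (m - 1 - P)) / ((ε ^ 2 + (m - 1)) * (ε ^ 2 + P)) := by
      rw [div_sub_div _ _ hD1p.ne' hD2p.ne']; ring
    rw [this, abs_div, abs_neg, abs_mul, abs_of_pos hε2, abs_of_pos (mul_pos hD1p hD2p),
      div_le_iff₀ (mul_pos hD1p hD2p)]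
    calc ε ^ 2 * |m - 1 - P| ≤ ε ^ 2 * (C * (ε ^ 2 + q) ^ 2) := by
          gcongr
          refine hr.trans ?_
          gcongr; linarith
      _ = 2 * C / c ^ 2 * ε ^ 2 * ((c / 2 * (ε ^ 2 + q)) * (c * (ε ^ 2 + q))) := by
          field_simp
      _ ≤ _ := by gcongr
  refine main.trans ?_
  have hεW : ε ^ 2 ≤ 3 * W⁻¹ := by
    rw [← div_eq_mul_inv, le_div_iff₀ hW1, hW]; nlinarith
  have hfin : ε ^ 2 ≤ 3 * (ε ^ (1 - θ) * W ^ (-(1 + θ) / 2)) := by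
    have h1 : ε ^ 2 = ε ^ (1 - θ) * (ε ^ 2) ^ ((1 + θ) / 2) := by
      rw [← Real.rpow_natCast ε 2, ← Real.rpow_mul hε.le, ← Real.rpow_add hε]
      congr 1; push_cast; ring
    have h2 : (ε ^ 2) ^ ((1 + θ) / 2) ≤ 3 * W ^ (-(1 + θ) / 2) := by
      calc (ε ^ 2) ^ ((1 + θ) / 2) ≤ (3 * W⁻¹) ^ ((1 + θ) / 2) :=
            Real.rpow_le_rpow hε2.le hεW (by linarith)
        _ = 3 ^ ((1 + θ) / 2) * W ^ (-(1 + θ) / 2) := by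
            rw [Real.mul_rpow (by norm_num) (by positivity), Real.inv_rpow hW1.le,
              ← Real.rpow_neg hW1.le, neg_div]
        _ ≤ 3 * W ^ (-(1 + θ) / 2) := by
            gcongr
            calc (3 : ℝ) ^ ((1 + θ) / 2) ≤ 3 ^ (1 : ℝ) :=
                  Real.rpow_le_rpow_of_exponent_le (by norm_num) (by linarith)
              _ = 3 := Real.rpow_one 3
    calc ε ^ 2 = ε ^ (1 - θ) * (ε ^ 2) ^ ((1 + θ) / 2) := h1
      _ ≤ ε ^ (1 - θ) * (3 * W ^ (-(1 + θ) / 2)) := by gcongr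
      _ = _ := by ring
  calc 2 * C / c ^ 2 * ε ^ 2 ≤ 2 * C / c ^ 2 * (3 * (ε ^ (1 - θ) * W ^ (-(1 + θ) / 2))) := by gcongr
    _ = _ := by ring
end
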